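/- Let S be a finite set and x an S-cube in an abelian category. Then the following are equivalent: (1) x is admissible; (2) the total complex Tot x is 0-spherical (i.e., H_k(Tot x) = 0 for all k ≠ 0) and all faces of x are admissible. -/

import Mathlib

open CategoryTheory CategoryTheory.Limits Opposite

attribute [local instance] CategoryTheory.Abelian.hasFiniteBiproducts

set_option linter.unusedSectionVars false

universe w v u

/-- An `ι`-cube in a category `𝒜`: a contravariant functor from the poset of finite
subsets of `ι` (ordered by inclusion) to `𝒜`.  An `S`-cube (for `S : Finset ι`) is such a
functor, of which only the values on subsets of `S` are relevant. -/
abbrev Cube (𝒜 : Type u) [Category.{v} 𝒜] (ι : Type w) := (Finset ι)ᵒᵖ ⥤ 𝒜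

namespace Cube

variable {𝒜 : Type u} [Category.{v} 𝒜] {ι : Type w} [DecidableEq ι]

/-- The vertex `x_T` of a cube `x` at a finite subset `T`. -/
def vtx (x : Cube 𝒜 ι) (T : Finset ι) : 𝒜 := x.obj (op T)

/-- The structure morphism `x_T ⟶ x_U` of a cube for `U ⊆ T`. -/
def mapLE (x : Cube 𝒜 ι) {T U : Finset ι} (h : U ⊆ T) : x.vtx T ⟶ x.vtx U :=
  x.map (homOfLE h).op

lemma mapLE_refl (x : Cube 𝒜 ι) (T : Finset ι) (h : T ⊆ T) : x.mapLE h = 𝟙 (x.vtx T) := by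
  show x.map (homOfLE h).op = _
  rw [show (homOfLE h).op = 𝟙 (op T) from rfl, x.map_id]; rfl

lemma mapLE_comp (x : Cube 𝒜 ι) {T U V : Finset ι} (h1 : U ⊆ T) (h2 : V ⊆ U) :
    x.mapLE h1 ≫ x.mapLE h2 = x.mapLE (h2.trans h1) := by
  show x.map _ ≫ x.map _ = x.map _
  rw [← x.map_comp]
  rfl

/-- The `k`-direction boundary morphism `d^k_T : x_T ⟶ x_{T ∖ {k}}` of a cube. -/
def bd (x : Cube 𝒜 ι) (T : Finset ι) (k : ι) : x.vtx T ⟶ x.vtx (T.erase k) :=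
  x.mapLE (Finset.erase_subset k T)

/-- The `k`-direction `0`-th homology `H⁰ₖ(x)` of a cube in an abelian category, an
`(S ∖ {k})`-cube: its vertex at `T` is the cokernel of the boundary morphism
`d^k_{T ∪ {k}} : x_{T ∪ {k}} ⟶ x_{(T ∪ {k}) ∖ {k}}`. -/
noncomputable def H0 [Abelian 𝒜] (x : Cube 𝒜 ι) (k : ι) : Cube 𝒜 ι where
  obj T := cokernel (x.bd (insert k T.unop) k)
  map {T U} f :=
    cokernel.map _ _
      (x.mapLE (Finset.insert_subset_insert k (leOfHom f.unop)))
      (x.mapLE (Finset.erase_subset_erase k (Finset.insert_subset_insert k (leOfHom f.unop))))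
      (by rw [bd, bd, mapLE_comp, mapLE_comp])
  map_id T := by
    apply coequalizer.hom_ext
    simp [cokernel.map]
    rw [mapLE_refl]
    simp
  map_comp {T U V} f g := by
    apply coequalizer.hom_ext
    simp [cokernel.map]
    rw [← Category.assoc, mapLE_comp]

/-- Admissibility of an `S`-cube `x` in an abelian category, by recursion on `#S`:
`x` is admissible if all its boundary morphisms `d^k_T` (`k ∈ T ⊆ S`) are monomorphisms and
for every `k ∈ S` the `(S ∖ {k})`-cube `H⁰ₖ(x)` is admissible.  (For `S = ∅` the conditions
are vacuous, and for `#S = 1` this says exactly that the boundary morphism of `x` is a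
monomorphism.) -/
def Admissible [Abelian 𝒜] (x : Cube 𝒜 ι) (S : Finset ι) : Prop :=
  (∀ T ⊆ S, ∀ k ∈ T, Mono (x.bd T k)) ∧
  ∀ k, (hk : k ∈ S) → Admissible (x.H0 k) (S.erase k)
termination_by S.card
decreasing_by exact Finset.card_erase_lt_of_mem hk

/-- Iterated `0`-th homology:
`H0s x [i₁, …, i_r] = H⁰_{i₁}(H⁰_{i₂}(⋯(H⁰_{i_r}(x))⋯))`. -/
noncomputable def H0s [Abelian 𝒜] (x : Cube 𝒜 ι) : List ι → Cube 𝒜 ι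
  | [] => x
  | k :: ks => (x.H0s ks).H0 k

/-- The restriction `x|_U^V` of a cube to `U` along `V` (for disjoint `U`, `V`): the
`U`-cube `T ↦ x_{T ∪ V}`.  (It is implemented as the cube `T ↦ x_{(T ∩ U) ∪ V}`, whose
vertex at any subset `T ⊆ U` is exactly `x_{T ∪ V}`.) -/
def res (x : Cube 𝒜 ι) (U V : Finset ι) : Cube 𝒜 ι :=
  (Monotone.functor (f := fun T : Finset ι => (T ∩ U) ∪ V)
    (fun _ _ h => Finset.union_subset_union (Finset.inter_subset_inter h (subset_refl U))
      (subset_refl V))).op ⋙ x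

/-- The `n`-th object `(Tot x)_n = ⊕_{T ⊆ S, #T = n} x_T` of the total complex of an
`S`-cube. -/
noncomputable def totObj [Abelian 𝒜] (x : Cube 𝒜 ι) (S : Finset ι) (n : ℕ) : 𝒜 :=
  ⨁ (fun T : {T : Finset ι // T ∈ Finset.powersetCard n S} => x.vtx T.1)

/-- The differential `(Tot x)_{n+1} ⟶ (Tot x)_n` of the total complex of an `S`-cube:
its component from `x_T` to `x_{T ∖ {j}}` (for `j ∈ T`) is `(-1)^{#{t ∈ T | t > j}} ⬝ d^j_T`. -/
noncomputable def totD [Abelian 𝒜] [LinearOrder ι] (x : Cube 𝒜 ι) (S : Finset ι) (n : ℕ) :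
    x.totObj S (n+1) ⟶ x.totObj S n := by
  unfold totObj
  exact biproduct.desc fun (T : {T : Finset ι // T ∈ Finset.powersetCard (n+1) S}) =>
    biproduct.lift fun (T' : {T : Finset ι // T ∈ Finset.powersetCard n S}) =>
      ∑ j ∈ T.1, if h : T'.1 = T.1.erase j then
        ((-1 : ℤ) ^ (T.1.filter (fun t => j < t)).card) •
          (x.bd T.1 j ≫ eqToHom (congrArg x.vtx h.symm))
      else 0

end Cube

namespace Cube

section Aux

variable {𝒜 : Type u} [Category.{v} 𝒜] [Abelian 𝒜] {ι : Type w} [LinearOrder ι]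

/-- sign -/
def sgn (j : ι) (U : Finset ι) : ℤ := (-1) ^ (U.filter (fun t => j < t)).card

lemma sgn_sq (j : ι) (U : Finset ι) : sgn j U * sgn j U = 1 := by
  unfold sgn
  rw [← mul_pow]; simp

lemma sgn_insert_self (j : ι) (U : Finset ι) : sgn j (insert j U) = sgn j U := by
  unfold sgn
  rw [Finset.filter_insert]; simp

lemma sgn_insert (i j : ι) (U : Finset ι) (hj : j ∉ U) :
    sgn i (insert j U) = if i < j then - sgn i U else sgn i U := by
  unfold sgn
  rw [Finset.filter_insert]
  split_ifs with h
  · rw [Finset.card_insert_of_notMem (by simp [hj]), pow_succ]; simp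
  · rfl

lemma sgn_anti (i j : ι) (U : Finset ι) (hij : i ≠ j) (hi : i ∉ U) (hj : j ∉ U) :
    sgn j U * sgn i (insert j U) + sgn i U * sgn j (insert i U) = 0 := by
  rw [sgn_insert i j U hj, sgn_insert j i U hi]
  rcases lt_or_gt_of_ne hij with h | h
  · simp [h, not_lt.2 h.le]; ring
  · simp [h, not_lt.2 h.le]; ring

/-- lowering a component -/
def low (x : Cube 𝒜 ι) {A : 𝒜} (z : ∀ T : Finset ι, A ⟶ x.vtx T) (T U : Finset ι) :
    A ⟶ x.vtx U :=
  open Classical in if h : U ⊆ T then z T ≫ x.mapLE h else 0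

lemma low_of (x : Cube 𝒜 ι) {A : 𝒜} (z : ∀ T : Finset ι, A ⟶ x.vtx T) {T U : Finset ι}
    (h : U ⊆ T) : x.low z T U = z T ≫ x.mapLE h := by
  unfold low; rw [dif_pos h]

lemma low_comp (x : Cube 𝒜 ι) {A : 𝒜} (z : ∀ T : Finset ι, A ⟶ x.vtx T) {T U V : Finset ι}
    (h : U ⊆ T) (h' : V ⊆ U) : x.low z T U ≫ x.mapLE h' = x.low z T V := by
  rw [low_of _ _ h, low_of _ _ (h'.trans h), Category.assoc, mapLE_comp]

/-- the differential on families -/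
def DD (x : Cube 𝒜 ι) (S : Finset ι) {A : 𝒜} (z : ∀ T : Finset ι, A ⟶ x.vtx T) (U : Finset ι) :
    A ⟶ x.vtx U :=
  ∑ j ∈ S \ U, sgn j U • x.low z (insert j U) U

lemma DD_congr (x : Cube 𝒜 ι) (S : Finset ι) {A : 𝒜} (z z' : ∀ T : Finset ι, A ⟶ x.vtx T)
    (U : Finset ι) (hU : U ⊆ S) (h : ∀ T ⊆ S, T.card = U.card + 1 → z T = z' T) :
    x.DD S z U = x.DD S z' U := by
  unfold DD
  refine Finset.sum_congr rfl fun j hj => ?_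
  rw [Finset.mem_sdiff] at hj
  rw [low_of _ _ (Finset.subset_insert _ _), low_of _ _ (Finset.subset_insert _ _),
    h _ (Finset.insert_subset hj.1 hU) (Finset.card_insert_of_notMem hj.2)]

lemma DD_sub (x : Cube 𝒜 ι) (S : Finset ι) {A : 𝒜} (z z' : ∀ T : Finset ι, A ⟶ x.vtx T)
    (U : Finset ι) : x.DD S (fun T => z T - z' T) U = x.DD S z U - x.DD S z' U := by
  unfold DD
  rw [← Finset.sum_sub_distrib]
  refine Finset.sum_congr rfl fun j hj => ?_
  simp only [low_of _ _ (Finset.subset_insert j U), Preadditive.sub_comp, smul_sub]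

lemma DD_add (x : Cube 𝒜 ι) (S : Finset ι) {A : 𝒜} (z z' : ∀ T : Finset ι, A ⟶ x.vtx T)
    (U : Finset ι) : x.DD S (fun T => z T + z' T) U = x.DD S z U + x.DD S z' U := by
  unfold DD
  rw [← Finset.sum_add_distrib]
  refine Finset.sum_congr rfl fun j hj => ?_
  simp only [low_of _ _ (Finset.subset_insert j U), Preadditive.add_comp, smul_add]

lemma DD_pre (x : Cube 𝒜 ι) (S : Finset ι) {A B : 𝒜} (p : B ⟶ A)
    (z : ∀ T : Finset ι, A ⟶ x.vtx T)
    (U : Finset ι) : x.DD S (fun T => p ≫ z T) U = p ≫ x.DD S z U := by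
  unfold DD
  rw [Preadditive.comp_sum]
  refine Finset.sum_congr rfl fun j hj => ?_
  simp only [low_of _ _ (Finset.subset_insert j U), Category.assoc, Preadditive.comp_zsmul]

lemma DD_DD (x : Cube 𝒜 ι) (S : Finset ι) {A : 𝒜} (z : ∀ T : Finset ι, A ⟶ x.vtx T)
    (U : Finset ι) : x.DD S (fun T => x.DD S z T) U = 0 := by
  have h1 : ∀ j ∈ S \ U, sgn j U • x.low (fun T => x.DD S z T) (insert j U) U =
      ∑ i ∈ S \ insert j U, (sgn j U * sgn i (insert j U)) •
        x.low z (insert i (insert j U)) U := by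
    intro j hj
    rw [low_of _ _ (Finset.subset_insert j U)]
    unfold DD
    rw [Preadditive.sum_comp, Finset.smul_sum]
    refine Finset.sum_congr rfl fun i hi => ?_
    rw [Preadditive.zsmul_comp, low_comp _ _ (Finset.subset_insert _ _), smul_smul]
  rw [DD, Finset.sum_congr rfl h1, Finset.sum_sigma']
  refine Finset.sum_involution (fun a _ => ⟨a.2, a.1⟩) ?_ ?_ ?_ ?_
  · rintro ⟨j, i⟩ h
    simp only [Finset.mem_sigma, Finset.mem_sdiff, Finset.mem_insert, not_or] at h
    dsimp only
    rw [Finset.insert_comm j i U, ← add_smul, sgn_anti i j U h.2.2.1 h.2.2.2 h.1.2, zero_smul]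
  · rintro ⟨j, i⟩ h _ h3
    simp only [Finset.mem_sigma, Finset.mem_sdiff, Finset.mem_insert, not_or] at h
    simp only [Sigma.mk.injEq] at h3
    exact h.2.2.1 h3.1
  · rintro ⟨j, i⟩ h
    simp only [Finset.mem_sigma, Finset.mem_sdiff, Finset.mem_insert, not_or] at h ⊢
    exact ⟨⟨h.2.1, h.2.2.2⟩, h.1.1, fun e => h.2.2.1 e.symm, h.1.2⟩
  · rintro ⟨j, i⟩ h
    rfl

/-- typed projection -/
noncomputable def tpi (x : Cube 𝒜 ι) (S : Finset ι) (n : ℕ) (T : Finset ι)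
    (hT : T ∈ Finset.powersetCard n S) : x.totObj S n ⟶ x.vtx T :=
  biproduct.π (fun T : {T : Finset ι // T ∈ Finset.powersetCard n S} => x.vtx T.1) ⟨T, hT⟩

/-- typed lift -/
noncomputable def tlift (x : Cube 𝒜 ι) (S : Finset ι) (n : ℕ) {A : 𝒜}
    (z : ∀ T : Finset ι, A ⟶ x.vtx T) : A ⟶ x.totObj S n :=
  biproduct.lift (f := fun T : {T : Finset ι // T ∈ Finset.powersetCard n S} => x.vtx T.1)
    (fun T => z T.1)

lemma tlift_tpi (x : Cube 𝒜 ι) (S : Finset ι) (n : ℕ) {A : 𝒜}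
    (z : ∀ T : Finset ι, A ⟶ x.vtx T) (T : Finset ι)
    (hT : T ∈ Finset.powersetCard n S) : x.tlift S n z ≫ x.tpi S n T hT = z T :=
  biproduct.lift_π _ _

lemma tot_ext (x : Cube 𝒜 ι) (S : Finset ι) (n : ℕ) {A : 𝒜} (f g : A ⟶ x.totObj S n)
    (h : ∀ T (hT : T ∈ Finset.powersetCard n S),
      f ≫ x.tpi S n T hT = g ≫ x.tpi S n T hT) : f = g :=
  biproduct.hom_ext _ _ (fun T => h T.1 T.2)

lemma lift_desc_pi {J K : Type*} [Fintype J] [Finite K] {f : J → 𝒜} {g : K → 𝒜} {A : 𝒜}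
    (a : ∀ i, A ⟶ f i) (m : ∀ i l, f i ⟶ g l) (l : K) :
    (biproduct.lift a ≫ biproduct.desc (fun i => biproduct.lift (m i))) ≫ biproduct.π g l =
      ∑ i, a i ≫ m i l := by
  classical
  have h : biproduct.desc (fun i => biproduct.lift (m i)) =
      ∑ j, biproduct.π f j ≫ biproduct.lift (m j) := by
    apply biproduct.hom_ext'
    intro j
    simp [Preadditive.comp_sum, biproduct.ι_π_assoc, dite_comp]
  rw [h, Preadditive.comp_sum, Preadditive.sum_comp]
  simp

lemma totD_pi (x : Cube 𝒜 ι) (S : Finset ι) (n : ℕ) {A : 𝒜} (f : A ⟶ x.totObj S (n+1))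
    (z : ∀ T : Finset ι, A ⟶ x.vtx T)
    (hz : ∀ T (hT : T ∈ Finset.powersetCard (n+1) S), f ≫ x.tpi S (n+1) T hT = z T)
    (U : Finset ι) (hU : U ∈ Finset.powersetCard n S) :
    (f ≫ x.totD S n) ≫ x.tpi S n U hU = x.DD S z U := by
  have hf : f = x.tlift S (n+1) z := by
    apply tot_ext
    intro T hT
    rw [hz, tlift_tpi]
  have hU' := Finset.mem_powersetCard.1 hU
  have key : ∀ T : {T : Finset ι // T ∈ Finset.powersetCard (n+1) S},
      z T.1 ≫ (∑ j ∈ T.1, if h : U = T.1.erase j then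
        ((-1 : ℤ) ^ (T.1.filter (fun t => j < t)).card) •
          (x.bd T.1 j ≫ eqToHom (congrArg x.vtx h.symm))
      else 0) = ∑ j ∈ S \ U, if T.1 = insert j U then sgn j U • x.low z (insert j U) U else 0 := by
    rintro ⟨T, hT⟩
    have hT' := Finset.mem_powersetCard.1 hT
    dsimp only
    rw [Preadditive.comp_sum]
    have e1 : ∀ j ∈ T, (z T ≫ if h : U = T.erase j then
        ((-1 : ℤ) ^ (T.filter (fun t => j < t)).card) •
          (x.bd T j ≫ eqToHom (congrArg x.vtx h.symm))
      else 0) = if U = T.erase j then sgn j T • x.low z T U else 0 := by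
      intro j hj
      split_ifs with h
      · subst h
        rw [low_of _ _ (Finset.erase_subset _ _)]
        simp [sgn, bd]
      · simp
    rw [Finset.sum_congr rfl e1, ← Finset.sum_filter, ← Finset.sum_filter]
    refine Finset.sum_congr ?_ ?_
    · ext j
      simp only [Finset.mem_filter, Finset.mem_sdiff]
      constructor
      · rintro ⟨h1, rfl⟩
        exact ⟨⟨hT'.1 h1, by simp⟩, by rw [Finset.insert_erase h1]⟩
      · rintro ⟨⟨h1, h2⟩, rfl⟩
        exact ⟨by simp, by rw [Finset.erase_insert h2]⟩
    · intro j hj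
      simp only [Finset.mem_filter, Finset.mem_sdiff] at hj
      obtain ⟨⟨h1, h2⟩, rfl⟩ := hj
      rw [sgn_insert_self]
  rw [hf]
  have e2 : (x.tlift S (n+1) z ≫ x.totD S n) ≫ x.tpi S n U hU =
      ∑ T : {T : Finset ι // T ∈ Finset.powersetCard (n+1) S},
      z T.1 ≫ (∑ j ∈ T.1, if h : U = T.1.erase j then
        ((-1 : ℤ) ^ (T.1.filter (fun t => j < t)).card) •
          (x.bd T.1 j ≫ eqToHom (congrArg x.vtx h.symm))
      else 0) := by
    exact lift_desc_pi _ _ _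
  rw [e2]
  refine (Finset.sum_congr rfl (fun T _ => key T)).trans ?_
  rw [Finset.sum_comm]
  unfold DD
  refine Finset.sum_congr rfl fun j hj => ?_
  rw [Finset.mem_sdiff] at hj
  rw [Finset.sum_eq_single ⟨insert j U, Finset.mem_powersetCard.2
    ⟨Finset.insert_subset hj.1 hU'.1, by rw [Finset.card_insert_of_notMem hj.2, hU'.2]⟩⟩]
  · simp
  · intro b _ hb
    rw [if_neg]
    intro e
    exact hb (Subtype.ext e)
  · simp

/-- components -/
noncomputable def cmp (x : Cube 𝒜 ι) (S : Finset ι) (n : ℕ) {A : 𝒜} (f : A ⟶ x.totObj S n)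
    (T : Finset ι) : A ⟶ x.vtx T :=
  open Classical in
  if hT : T ∈ Finset.powersetCard n S then
    f ≫ x.tpi S n T hT
  else 0

lemma cmp_spec (x : Cube 𝒜 ι) (S : Finset ι) (n : ℕ) {A : 𝒜} (f : A ⟶ x.totObj S n)
    (T : Finset ι) (hT : T ∈ Finset.powersetCard n S) :
    f ≫ x.tpi S n T hT
      = x.cmp S n f T := by
  unfold cmp; rw [dif_pos hT]

lemma totD_totD (x : Cube 𝒜 ι) (S : Finset ι) (n : ℕ) : x.totD S (n+1) ≫ x.totD S n = 0 := by
  apply tot_ext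
  intro U hU
  have h := x.totD_pi S (n+1) (𝟙 _) (x.cmp S _ (𝟙 _)) (fun T hT => x.cmp_spec _ _ _ _ hT)
  rw [Category.id_comp] at h
  rw [totD_pi x S n _ _ h, DD_DD, zero_comp]

/-- exactness in terms of families -/
def ExactAt (x : Cube 𝒜 ι) (S : Finset ι) (n : ℕ) : Prop :=
  ∀ (A : 𝒜) (z : ∀ T : Finset ι, A ⟶ x.vtx T),
    (∀ U ⊆ S, U.card = n → x.DD S z U = 0) →
    ∃ (B : 𝒜) (p : B ⟶ A) (_ : Epi p) (w : ∀ T : Finset ι, B ⟶ x.vtx T),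
      ∀ T ⊆ S, T.card = n + 1 → p ≫ z T = x.DD S w T

lemma exact_iff (x : Cube 𝒜 ι) (S : Finset ι) (n : ℕ) :
    (ShortComplex.mk (x.totD S (n+1)) (x.totD S n) (x.totD_totD S n)).Exact ↔
      x.ExactAt S n := by
  rw [ShortComplex.exact_iff_exact_up_to_refinements]
  dsimp only
  constructor
  · intro H A z hz
    let f : A ⟶ x.totObj S (n+1) := x.tlift S (n+1) z
    have hf : ∀ T (hT : T ∈ Finset.powersetCard (n+1) S),
      f ≫ x.tpi S (n+1) T hT = z T := fun T hT => x.tlift_tpi _ _ _ _ _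
    obtain ⟨B, p, hp, g, hg⟩ := H f (by
      apply tot_ext
      intro U hU
      rw [totD_pi x S n f z hf U hU, zero_comp]
      rw [Finset.mem_powersetCard] at hU
      exact hz U hU.1 hU.2)
    refine ⟨B, p, hp, x.cmp S _ g, fun T hT hc => ?_⟩
    have hT' := Finset.mem_powersetCard.2 ⟨hT, hc⟩
    rw [← totD_pi x S (n+1) g _ (fun T hT => x.cmp_spec _ _ _ _ hT) T hT', ← hg,
      Category.assoc, hf]
  · intro H A f hf
    obtain ⟨B, p, hp, w, hw⟩ := H A (x.cmp S _ f) (fun U hU hc => by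
      have hU' := Finset.mem_powersetCard.2 ⟨hU, hc⟩
      rw [← totD_pi x S n f _ (fun T hT => x.cmp_spec _ _ _ _ hT) U hU', hf, zero_comp])
    refine ⟨B, p, hp, x.tlift S (n+1+1) w, ?_⟩
    apply tot_ext
    intro T hT
    rw [totD_pi x S (n+1) _ w (fun T hT => x.tlift_tpi _ _ _ _ _) T hT, Category.assoc, cmp_spec]
    rw [Finset.mem_powersetCard] at hT
    exact hw T hT.1 hT.2

/-- typed cokernel projection -/
noncomputable def cpi (x : Cube 𝒜 ι) (k : ι) (T : Finset ι) :
    x.vtx ((insert k T).erase k) ⟶ (x.H0 k).vtx T := cokernel.π (x.bd (insert k T) k)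

lemma bd_cpi (x : Cube 𝒜 ι) (k : ι) (T : Finset ι) : x.bd (insert k T) k ≫ x.cpi k T = 0 :=
  cokernel.condition _

instance cpi_epi (x : Cube 𝒜 ι) (k : ι) (T : Finset ι) : Epi (x.cpi k T) :=
  inferInstanceAs (Epi (cokernel.π (x.bd (insert k T) k)))

lemma cpi_nat (x : Cube 𝒜 ι) (k : ι) {T U : Finset ι} (h : U ⊆ T) :
    x.cpi k T ≫ (x.H0 k).mapLE h =
    x.mapLE (Finset.erase_subset_erase k (Finset.insert_subset_insert k h)) ≫ x.cpi k U :=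
  cokernel.π_desc _ _ _

/-- projection to H0 -/
noncomputable def q (x : Cube 𝒜 ι) (k : ι) (T : Finset ι) : x.vtx T ⟶ (x.H0 k).vtx T :=
  x.mapLE (show (insert k T).erase k ⊆ T by
    intro a ha; simp only [Finset.mem_erase, Finset.mem_insert] at ha; tauto) ≫ x.cpi k T

lemma q_nat (x : Cube 𝒜 ι) (k : ι) {T U : Finset ι} (h : U ⊆ T) :
    x.mapLE h ≫ x.q k U = x.q k T ≫ (x.H0 k).mapLE h := by
  unfold q
  rw [Category.assoc, cpi_nat, ← Category.assoc, ← Category.assoc, mapLE_comp, mapLE_comp]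

lemma q_zero (x : Cube 𝒜 ι) (k : ι) {T : Finset ι} (h : k ∈ T) : x.q k T = 0 := by
  unfold q
  have e : insert k T ⊆ T := by rw [Finset.insert_eq_of_mem h]
  have := x.bd_cpi k T
  rw [bd] at this
  rw [← x.mapLE_comp e (Finset.erase_subset _ _), Category.assoc, this, comp_zero]

lemma isIso_mapLE (x : Cube 𝒜 ι) {T U : Finset ι} (h : U ⊆ T) (e : T ⊆ U) :
    IsIso (x.mapLE h) :=
  ⟨x.mapLE e, by rw [mapLE_comp, mapLE_refl], by rw [mapLE_comp, mapLE_refl]⟩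

lemma erase_insert_sup {k : ι} {T : Finset ι} (h : k ∉ T) : T ⊆ (insert k T).erase k := by
  rw [Finset.erase_insert h]

lemma q_epi (x : Cube 𝒜 ι) (k : ι) {T : Finset ι} (h : k ∉ T) : Epi (x.q k T) := by
  unfold q
  have := x.isIso_mapLE (T := T) (U := (insert k T).erase k) (by rw [Finset.erase_insert h])
    (by rw [Finset.erase_insert h])
  exact epi_comp _ _

lemma mono_mapLE (x : Cube 𝒜 ι) {T U : Finset ι} (k : ι) (h : U ⊆ T) (e : U = T.erase k)
    (hm : Mono (x.bd T k)) : Mono (x.mapLE h) := by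
  subst e; exact hm

lemma q_lift (x : Cube 𝒜 ι) (k : ι) {T : Finset ι} (h : k ∉ T)
    (hm : Mono (x.bd (insert k T) k)) {A : 𝒜} (v : A ⟶ x.vtx T) (hv : v ≫ x.q k T = 0) :
    ∃ u : A ⟶ x.vtx (insert k T), u ≫ x.mapLE (Finset.subset_insert k T) = v := by
  unfold q at hv
  rw [← Category.assoc] at hv
  have hex := ShortComplex.exact_cokernel (x.bd (insert k T) k)
  have : Mono (ShortComplex.mk (x.bd (insert k T) k) (cokernel.π (x.bd (insert k T) k))
    (cokernel.condition _)).f := hm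
  refine ⟨hex.lift _ hv, ?_⟩
  have h2 := hex.lift_f _ hv
  dsimp only [bd] at h2
  have := x.isIso_mapLE (T := T) (U := (insert k T).erase k) (by rw [Finset.erase_insert h])
    (by rw [Finset.erase_insert h])
  rw [← cancel_mono (x.mapLE (T := T) (U := (insert k T).erase k)
    (by rw [Finset.erase_insert h])), Category.assoc, mapLE_comp]
  exact h2

lemma DD_q (x : Cube 𝒜 ι) (S : Finset ι) (k : ι) {A : 𝒜} (z : ∀ T : Finset ι, A ⟶ x.vtx T)
    (U : Finset ι) :
    (x.H0 k).DD (S.erase k) (fun T => z T ≫ x.q k T) U = x.DD S z U ≫ x.q k U := by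
  unfold DD
  rw [Preadditive.sum_comp]
  have hs : S.erase k \ U ⊆ S \ U := Finset.sdiff_subset_sdiff (Finset.erase_subset _ _) le_rfl
  have hterm : ∀ j, (sgn j U • x.low z (insert j U) U) ≫ x.q k U =
    sgn j U • (x.H0 k).low (fun T => z T ≫ x.q k T) (insert j U) U := by
    intro j
    rw [low_of _ _ (Finset.subset_insert _ _), low_of _ _ (Finset.subset_insert _ _),
      Preadditive.zsmul_comp, Category.assoc, Category.assoc, q_nat]
  simp only [hterm]
  refine Finset.sum_subset hs ?_
  intro j hj hj'
  have : j = k := by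
    simp only [Finset.mem_sdiff, Finset.mem_erase] at hj hj'; tauto
  subst this
  rw [low_of _ _ (Finset.subset_insert _ _), q_zero _ _ (Finset.mem_insert_self _ _)]
  simp

/-- monos in direction `k` -/
def MonoDir (x : Cube 𝒜 ι) (S : Finset ι) (k : ι) : Prop := ∀ T ⊆ S, k ∈ T → Mono (x.bd T k)

lemma DD_single (x : Cube 𝒜 ι) (S : Finset ι) (k : ι) (hk : k ∈ S) {A : 𝒜}
    (z : ∀ T : Finset ι, A ⟶ x.vtx T) (U : Finset ι) (hU : U ⊆ S) (hkU : k ∉ U)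
    (hz : ∀ T ⊆ S, T.card = U.card + 1 → k ∉ T → z T = 0) :
    x.DD S z U = sgn k U • (z (insert k U) ≫ x.mapLE (Finset.subset_insert k U)) := by
  unfold DD
  rw [Finset.sum_eq_single k, low_of _ _ (Finset.subset_insert _ _)]
  · intro j hj hjk
    rw [Finset.mem_sdiff] at hj
    rw [low_of _ _ (Finset.subset_insert _ _), hz _ (Finset.insert_subset hj.1 hU)
      (Finset.card_insert_of_notMem hj.2), zero_comp, smul_zero]
    simp only [Finset.mem_insert, not_or]
    exact ⟨fun e => hjk e.symm, hkU⟩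
  · intro h
    exact absurd (Finset.mem_sdiff.2 ⟨hk, hkU⟩) h

lemma ker_boundary (x : Cube 𝒜 ι) (S : Finset ι) (k : ι) (hk : k ∈ S) (hm : x.MonoDir S k)
    (n : ℕ) {A : 𝒜} (v : ∀ T : Finset ι, A ⟶ x.vtx T)
    (hq : ∀ T ⊆ S, T.card = n → k ∉ T → v T ≫ x.q k T = 0)
    (hd : ∀ U ⊆ S, U.card + 1 = n → x.DD S v U = 0) :
    ∃ u : ∀ T : Finset ι, A ⟶ x.vtx T, (∀ T, k ∉ T → u T = 0) ∧
      ∀ T ⊆ S, T.card = n → x.DD S u T = v T := by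
  have ex : ∀ T : Finset ι, ∃ u : A ⟶ x.vtx T, (k ∉ T → u = 0) ∧
      ∀ U (hU : T = insert k U), k ∉ U → U ⊆ S → U.card = n →
        u ≫ x.mapLE (hU ▸ Finset.subset_insert k U) = sgn k U • v U := by
    intro T
    by_cases hT : ∃ U, T = insert k U ∧ k ∉ U ∧ U ⊆ S ∧ U.card = n
    · obtain ⟨U, rfl, h1, h2, h3⟩ := hT
      obtain ⟨u, hu⟩ := x.q_lift k h1 (hm _ (Finset.insert_subset hk h2)
        (Finset.mem_insert_self _ _)) (sgn k U • v U) (by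
          rw [Preadditive.zsmul_comp, hq U h2 h3 h1, smul_zero])
      refine ⟨u, fun h => absurd (Finset.mem_insert_self _ _) h, ?_⟩
      intro U' hU' h1' _ _
      have : U = U' := by
        rw [← Finset.erase_insert h1, hU', Finset.erase_insert h1']
      subst this
      exact hu
    · refine ⟨0, fun _ => rfl, ?_⟩
      intro U hU h1 h2 h3
      exact absurd ⟨U, hU, h1, h2, h3⟩ hT
  choose u hu0 hu using ex
  have hnot : ∀ T ⊆ S, T.card = n → k ∉ T → x.DD S u T = v T := by
    intro T hT hc hkT
    rw [DD_single x S k hk u T hT hkT (fun T _ _ h => hu0 T h), hu _ T rfl hkT hT hc, smul_smul,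
      sgn_sq, one_smul]
  refine ⟨u, hu0, ?_⟩
  intro T hT hc
  by_cases hkT : k ∈ T
  · obtain ⟨U, hkU, rfl⟩ : ∃ U, k ∉ U ∧ insert k U = T :=
      ⟨T.erase k, by simp, Finset.insert_erase hkT⟩
    have hUS : U ⊆ S := (Finset.subset_insert _ _).trans hT
    rw [Finset.card_insert_of_notMem hkU] at hc
    have h0 : x.DD S (fun T => v T - x.DD S u T) U = 0 := by
      rw [DD_sub, DD_DD, hd U hUS hc, sub_zero]
    rw [DD_single x S k hk _ U hUS hkU (fun T h1 h2 h3 => by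
      rw [hnot T h1 (h2.trans hc) h3, sub_self])] at h0
    have h1 := congrArg (fun f => sgn k U • f) h0
    simp only [smul_smul, sgn_sq, one_smul, smul_zero] at h1
    have := x.mono_mapLE k (Finset.subset_insert k U) (Finset.erase_insert hkU).symm
      (hm _ hT (Finset.mem_insert_self _ _))
    have h2 := zero_of_comp_mono _ h1
    exact (sub_eq_zero.1 h2).symm
  · exact hnot T hT hc hkT

lemma exactAt_iff_H0 (x : Cube 𝒜 ι) (S : Finset ι) (k : ι) (hk : k ∈ S) (hm : x.MonoDir S k)
    (n : ℕ) : x.ExactAt S n ↔ (x.H0 k).ExactAt (S.erase k) n := by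
  have hsub : ∀ {T : Finset ι}, T ⊆ S.erase k → T ⊆ S ∧ k ∉ T := fun {T} h =>
    ⟨h.trans (Finset.erase_subset _ _), fun h' => Finset.notMem_erase k S (h h')⟩
  have hlift : ∀ {A : 𝒜} (z : ∀ T : Finset ι, A ⟶ (x.H0 k).vtx T),
      ∃ (B : 𝒜) (p : B ⟶ A) (_ : Epi p) (w : ∀ T : Finset ι, B ⟶ x.vtx T),
        ∀ T ⊆ S.erase k, p ≫ z T = w T ≫ x.q k T := by
    intro A z
    have aux : ∀ F : Finset (Finset ι), (∀ T ∈ F, k ∉ T) →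
        ∃ (B : 𝒜) (p : B ⟶ A) (_ : Epi p) (w : ∀ T : Finset ι, B ⟶ x.vtx T),
        ∀ T ∈ F, p ≫ z T = w T ≫ x.q k T := by
      classical
      intro F
      induction F using Finset.induction_on with
      | empty => exact fun _ => ⟨A, 𝟙 A, inferInstance, fun T => 0, by simp⟩
      | insert T₀ F hT₀ ih =>
        intro hF
        obtain ⟨B, p, hp, w, hw⟩ := ih (fun T hT => hF T (Finset.mem_insert_of_mem hT))
        have := x.q_epi k (hF T₀ (Finset.mem_insert_self _ _))
        obtain ⟨C, p', hp', u, hu⟩ := surjective_up_to_refinements_of_epi (x.q k T₀) (p ≫ z T₀)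
        refine ⟨C, p' ≫ p, epi_comp _ _, Function.update (fun T => p' ≫ w T) T₀ u, ?_⟩
        intro T hT
        by_cases h : T = T₀
        · subst h
          rw [Function.update_self, ← hu, Category.assoc]
        · rw [Function.update_of_ne h, Category.assoc, Category.assoc,
            hw T ((Finset.mem_insert.1 hT).resolve_left h)]
    obtain ⟨B, p, hp, w, hw⟩ := aux (S.erase k).powerset
      (fun T hT => (hsub (Finset.mem_powerset.1 hT)).2)
    exact ⟨B, p, hp, w, fun T hT => hw T (Finset.mem_powerset.2 hT)⟩
  constructor
  · intro H A z' hz'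
    obtain ⟨B, p, hp, z, hz⟩ := hlift z'
    obtain ⟨u, hu0, hu⟩ := x.ker_boundary S k hk hm n (fun T => x.DD S z T) (by
      intro T hT hc hkT
      have hT' : T ⊆ S.erase k := fun a ha =>
        Finset.mem_erase.2 ⟨fun e => hkT (e ▸ ha), hT ha⟩
      rw [← DD_q, DD_congr _ _ _ (fun T => p ≫ z' T) _ hT' (fun T h _ => (hz T h).symm), DD_pre,
        hz' T hT' hc, comp_zero]) (fun U _ _ => x.DD_DD S z U)
    obtain ⟨C, p', hp', w, hw⟩ := H B (fun T => z T - u T) (by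
      intro U hU hc
      rw [DD_sub, hu U hU hc, sub_self])
    refine ⟨C, p' ≫ p, epi_comp _ _, fun T => w T ≫ x.q k T, ?_⟩
    intro T hT hc
    obtain ⟨h1, h2⟩ := hsub hT
    rw [DD_q, ← hw T h1 hc, hu0 T h2, sub_zero, Category.assoc, Category.assoc, hz T hT]
  · intro H A z hz
    obtain ⟨B, p, hp, w', hw'⟩ := H A (fun T => z T ≫ x.q k T) (by
      intro U hU hc
      rw [DD_q, hz U (hsub hU).1 hc, zero_comp])
    obtain ⟨C, p', hp', w, hw⟩ := hlift w'
    obtain ⟨u, hu0, hu⟩ := x.ker_boundary S k hk hm (n+1)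
      (fun T => (p' ≫ p) ≫ z T - x.DD S w T) (by
      intro T hT hc hkT
      have hT' : T ⊆ S.erase k := fun a ha =>
        Finset.mem_erase.2 ⟨fun e => hkT (e ▸ ha), hT ha⟩
      rw [Preadditive.sub_comp, ← DD_q, DD_congr _ _ _ (fun T => p' ≫ w' T) _ hT'
        (fun T h _ => (hw T h).symm), DD_pre, Category.assoc, Category.assoc, hw' T hT' hc,
        sub_self]) (by
      intro U hU hc
      rw [DD_sub, DD_DD, DD_pre, hz U hU (by omega), comp_zero, sub_zero])
    refine ⟨C, p' ≫ p, epi_comp _ _, fun T => u T + w T, ?_⟩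
    intro T hT hc
    rw [DD_add, hu T hT hc, sub_add_cancel]

/-- `y` restricted to `S` is the face of `x` along `V`. -/
structure Rel (S V : Finset ι) (x y : Cube 𝒜 ι) where
  e : ∀ T : Finset ι, T ⊆ S → (y.vtx T ≅ x.vtx (T ∪ V))
  nat : ∀ (T U : Finset ι) (h : U ⊆ T) (hT : T ⊆ S),
    y.mapLE h ≫ (e U (h.trans hT)).hom =
      (e T hT).hom ≫ x.mapLE (Finset.union_subset_union_left h)

/-- iso from equality -/
def eIso (x : Cube 𝒜 ι) {T U : Finset ι} (h : T = U) : x.vtx T ≅ x.vtx U where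
  hom := x.mapLE h.ge
  inv := x.mapLE h.le
  hom_inv_id := by rw [mapLE_comp, mapLE_refl]
  inv_hom_id := by rw [mapLE_comp, mapLE_refl]

/-- the face -/
def Rel.ofRes (S V : Finset ι) (x : Cube 𝒜 ι) : Rel S V x (x.res S V) where
  e T hT := x.eIso (T := (T ∩ S) ∪ V) (by rw [Finset.inter_eq_left.2 hT])
  nat T U h hT := by
    have : (x.res S V).mapLE h = x.mapLE (T := (T ∩ S) ∪ V) (U := (U ∩ S) ∪ V)
      (Finset.union_subset_union (Finset.inter_subset_inter h (subset_refl S)) (subset_refl V)) :=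
      rfl
    rw [this]
    exact (x.mapLE_comp _ _).trans (x.mapLE_comp _ _).symm

/-- mutual comparison -/
def Rel.comm {S V : Finset ι} {x y z : Cube 𝒜 ι} (a : Rel S V x y) (b : Rel S V x z) :
    Rel S ∅ y z where
  e T hT := b.e T hT ≪≫ (a.e T hT).symm ≪≫ y.eIso (Finset.union_empty T).symm
  nat T U h hT := by
    have h1 := b.nat T U h hT
    have h2 := a.nat T U h hT
    have h3 : x.mapLE (Finset.union_subset_union_left h) ≫ (a.e U (h.trans hT)).inv =
        (a.e T hT).inv ≫ y.mapLE h := by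
      rw [Iso.comp_inv_eq, Category.assoc, h2, Iso.inv_hom_id_assoc]
    simp only [Iso.trans_hom, Iso.symm_hom, Category.assoc, eIso]
    rw [reassoc_of% h1, reassoc_of% h3, mapLE_comp, mapLE_comp]

lemma Rel.mono {S V : Finset ι} {x y : Cube 𝒜 ι} (a : Rel S V x y) {T : Finset ι} (hT : T ⊆ S)
    {k : ι} (hk : k ∉ V) : Mono (y.bd T k) ↔ Mono (x.bd (T ∪ V) k) := by
  have h := a.nat T (T.erase k) (Finset.erase_subset _ _) hT
  have e : T.erase k ∪ V = (T ∪ V).erase k := by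
    rw [Finset.erase_union_distrib, Finset.erase_eq_of_notMem hk]
  have h2 : x.bd (T ∪ V) k = (a.e T hT).inv ≫ y.bd T k ≫
      (a.e _ ((Finset.erase_subset _ _).trans hT)).hom ≫ (x.eIso e).hom := by
    unfold bd
    rw [reassoc_of% h, Iso.inv_hom_id_assoc]
    exact (x.mapLE_comp _ _).symm
  rw [h2]
  constructor
  · intro h; infer_instance
  · intro h
    have h3 : y.bd T k = (a.e T hT).hom ≫ ((a.e T hT).inv ≫ y.bd T k ≫
      (a.e _ ((Finset.erase_subset _ _).trans hT)).hom ≫ (x.eIso e).hom) ≫ (x.eIso e).inv ≫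
      (a.e _ ((Finset.erase_subset _ _).trans hT)).inv := by simp
    rw [h3]
    infer_instance

lemma erase_aux {k : ι} {V : Finset ι} (hkV : k ∉ V) (T : Finset ι) :
    (insert k T).erase k ∪ V = (insert k (T ∪ V)).erase k := by
  rw [← Finset.insert_union, Finset.erase_union_distrib, Finset.erase_eq_of_notMem hkV]

lemma ins_aux {S : Finset ι} {k : ι} (hk : k ∈ S) {T : Finset ι} (hT : T ⊆ S.erase k) :
    insert k T ⊆ S := Finset.insert_subset hk (hT.trans (Finset.erase_subset _ _))

/-- compatibility with H0 on vertices -/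
noncomputable def Rel.He {S V : Finset ι} {x y : Cube 𝒜 ι} (a : Rel S V x y) {k : ι} (hk : k ∈ S)
    (hkV : k ∉ V) (T : Finset ι) (hT : T ⊆ S.erase k) :
    (y.H0 k).vtx T ≅ (x.H0 k).vtx (T ∪ V) :=
  cokernel.mapIso (y.bd (insert k T) k) (x.bd (insert k (T ∪ V)) k)
      (a.e (insert k T) (ins_aux hk hT) ≪≫ x.eIso (Finset.insert_union k T V))
      (a.e ((insert k T).erase k) ((Finset.erase_subset _ _).trans (ins_aux hk hT)) ≪≫
        x.eIso (erase_aux hkV T))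
      (by
        have h := a.nat _ _ (Finset.erase_subset k (insert k T)) (ins_aux hk hT)
        simp only [Iso.trans_hom, eIso, bd, Category.assoc]
        rw [reassoc_of% h, mapLE_comp, mapLE_comp])

lemma Rel.cpi_He {S V : Finset ι} {x y : Cube 𝒜 ι} (a : Rel S V x y) {k : ι} (hk : k ∈ S)
    (hkV : k ∉ V) (T : Finset ι) (hT : T ⊆ S.erase k) :
    y.cpi k T ≫ (a.He hk hkV T hT).hom =
      (a.e ((insert k T).erase k) ((Finset.erase_subset _ _).trans (ins_aux hk hT))).hom ≫
        x.mapLE (erase_aux hkV T).ge ≫ x.cpi k (T ∪ V) :=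
  (cokernel.π_desc _ _ _).trans (Category.assoc _ _ _)

/-- compatibility with H0 -/
noncomputable def Rel.H0 {S V : Finset ι} {x y : Cube 𝒜 ι} (a : Rel S V x y) {k : ι} (hk : k ∈ S)
    (hkV : k ∉ V) : Rel (S.erase k) V (x.H0 k) (y.H0 k) where
  e T hT := a.He hk hkV T hT
  nat T U h hT := by
    have h1 := y.cpi_nat k h
    have h2 := a.cpi_He hk hkV T hT
    have h3 := a.nat _ _ (Finset.erase_subset_erase k (Finset.insert_subset_insert k h))
      ((Finset.erase_subset _ _).trans (ins_aux hk hT))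
    rw [← cancel_epi (y.cpi k T), reassoc_of% h1, reassoc_of% h2, a.cpi_He hk hkV U (h.trans hT),
      reassoc_of% h3, cpi_nat, ← Category.assoc (x.mapLE _) (x.mapLE _),
      ← Category.assoc (x.mapLE _) (x.mapLE _), mapLE_comp, mapLE_comp]

lemma Rel.adm (N : ℕ) : ∀ {S V W : Finset ι} {x y : Cube 𝒜 ι} (_ : Rel S V x y)
    (_ : S.card = N) (_ : S ∪ V ⊆ W) (_ : Disjoint S V) (_ : x.Admissible W), y.Admissible S := by
  induction N with
  | zero =>
    intro S V W x y a hc hW hd hx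
    rw [Finset.card_eq_zero] at hc
    subst hc
    rw [Admissible]
    refine ⟨fun T hT k hk => ?_, fun k hk => ?_⟩
    · exact absurd (hT hk) (Finset.notMem_empty _)
    · exact absurd hk (Finset.notMem_empty _)
  | succ N ih =>
    intro S V W x y a hc hW hd hx
    rw [Admissible] at hx ⊢
    have hV : ∀ k ∈ S, k ∉ V := fun k hk => Finset.disjoint_left.1 hd hk
    refine ⟨fun T hT k hk => ?_, fun k hk => ?_⟩
    · rw [a.mono hT (hV k (hT hk))]
      exact hx.1 _ ((Finset.union_subset_union_left hT).trans hW) k (Finset.mem_union_left _ hk)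
    · refine ih (a.H0 hk (hV k hk)) (by rw [Finset.card_erase_of_mem hk, hc]; rfl) ?_
        (hd.mono_left (Finset.erase_subset _ _)) (hx.2 k (hW (Finset.mem_union_left _ hk)))
      rw [← Finset.erase_eq_of_notMem (hV k hk), ← Finset.erase_union_distrib]
      exact Finset.erase_subset_erase _ hW

lemma face_adm {x : Cube 𝒜 ι} {S V : Finset ι} {k : ι} (hk : k ∈ S) (hV : V ⊆ {k})
    (hx : x.Admissible S) : (x.res (S.erase k) V).Admissible (S.erase k) := by
  refine Rel.adm _ (Rel.ofRes (S.erase k) V x) rfl ?_ ?_ hx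
  · refine Finset.union_subset (Finset.erase_subset _ _) (hV.trans ?_)
    simpa using hk
  · refine Finset.disjoint_left.2 fun a ha ha' => ?_
    have := Finset.mem_singleton.1 (hV ha')
    subst this
    simp at ha

lemma face_H0_adm {x : Cube 𝒜 ι} {S V : Finset ι} {k j : ι} (hk : k ∈ S) (hj : j ∈ S)
    (hjk : j ≠ k) (hV : V ⊆ {j}) (hx : (x.res (S.erase j) V).Admissible (S.erase j)) :
    ((x.H0 k).res ((S.erase k).erase j) V).Admissible ((S.erase k).erase j) := by
  have hkV : k ∉ V := fun h => hjk (Finset.mem_singleton.1 (hV h)).symm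
  have hk' : k ∈ S.erase j := Finset.mem_erase.2 ⟨hjk.symm, hk⟩
  have a := (Rel.ofRes (S.erase j) V x).H0 hk' hkV
  rw [Finset.erase_right_comm]
  have b := Rel.ofRes ((S.erase j).erase k) V (x.H0 k)
  rw [Admissible] at hx
  exact Rel.adm _ (a.comm b) rfl (by simp) (by simp) (hx.2 k hk')

lemma main (N : ℕ) : ∀ (x : Cube 𝒜 ι) (S : Finset ι), S.card = N → (x.Admissible S ↔
    (∀ n, x.ExactAt S n) ∧ ∀ k ∈ S, (x.res (S.erase k) {k}).Admissible (S.erase k) ∧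
          (x.res (S.erase k) ∅).Admissible (S.erase k)) := by
  induction N with
  | zero =>
    intro x S hc
    rw [Finset.card_eq_zero] at hc
    subst hc
    rw [Admissible]
    refine ⟨fun _ => ⟨fun n A z hz => ⟨A, 𝟙 A, inferInstance, z, fun T hT hc => ?_⟩, by simp⟩,
      fun _ => ⟨fun T hT k hk => ?_, fun k hk => ?_⟩⟩
    · rw [Finset.subset_empty.1 hT] at hc
      simp at hc
    · exact absurd (hT hk) (Finset.notMem_empty _)
    · exact absurd hk (Finset.notMem_empty _)
  | succ N ih =>
    intro x S hc
    constructor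
    · intro hx
      refine ⟨?_, fun k hk => ⟨face_adm hk le_rfl hx, face_adm hk (by simp) hx⟩⟩
      obtain ⟨k, hk⟩ : S.Nonempty := Finset.card_pos.1 (by omega)
      rw [Admissible] at hx
      intro n
      rw [x.exactAt_iff_H0 S k hk (fun T hT hkT => hx.1 T hT k hkT)]
      exact ((ih (x.H0 k) (S.erase k) (by rw [Finset.card_erase_of_mem hk, hc]; rfl)).1
        (hx.2 k hk)).1 n
    · rintro ⟨hE, hF⟩
      have hmono : ∀ T ⊆ S, ∀ k ∈ T, Mono (x.bd T k) := by
        intro T hT k hk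
        by_cases hj : ∃ j ∈ S, j ≠ k
        · obtain ⟨j, hjS, hjk⟩ := hj
          have hT' : T.erase j ⊆ S.erase j := Finset.erase_subset_erase _ hT
          have hk' : k ∈ T.erase j := Finset.mem_erase.2 ⟨hjk.symm, hk⟩
          by_cases hjT : j ∈ T
          · have h1 := (hF j hjS).1
            rw [Admissible] at h1
            have h2 := h1.1 _ hT' k hk'
            rw [(Rel.ofRes (S.erase j) {j} x).mono hT' (by simpa using hjk.symm)] at h2
            have e : T.erase j ∪ {j} = T := by
              rw [Finset.union_comm, ← Finset.insert_eq, Finset.insert_erase hjT]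
            rwa [e] at h2
          · have h1 := (hF j hjS).2
            rw [Admissible] at h1
            have h2 := h1.1 _ hT' k hk'
            rw [(Rel.ofRes (S.erase j) ∅ x).mono hT' (by simp)] at h2
            rwa [Finset.erase_eq_of_notMem hjT, Finset.union_empty] at h2
        · have hS : ∀ j ∈ S, j = k := by
            intro j hjS
            by_contra h
            exact hj ⟨j, hjS, h⟩
          have hS' : S = {k} := Finset.eq_singleton_iff_unique_mem.2 ⟨hT hk, hS⟩
          have hT' : T = {k} := Finset.eq_singleton_iff_unique_mem.2 ⟨hk, fun j h => hS j (hT h)⟩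
          subst hS' hT'
          refine Preadditive.mono_of_cancel_zero _ ?_
          intro A g hg
          classical
          let z : ∀ T : Finset ι, A ⟶ x.vtx T := fun T =>
            if h : T = {k} then g ≫ x.mapLE h.le else 0
          have hzk : z {k} = g := by simp [z, mapLE_refl]
          obtain ⟨B, p, hp, w, hw⟩ := hE 0 A z (by
            intro U hU hc
            rw [Finset.card_eq_zero] at hc
            subst hc
            rw [DD_single x {k} k (by simp) z ∅ hU (by simp)]
            · have hg' : z (insert k ∅) ≫ x.mapLE (Finset.subset_insert k ∅) = 0 := by
                have h5 : z (insert k ∅) = g := hzk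
                rw [h5]
                have h6 : (∅ : Finset ι) ⊆ ({k} : Finset ι).erase k := Finset.empty_subset _
                have h7 : x.mapLE (Finset.subset_insert k ∅) = x.bd {k} k ≫ x.mapLE h6 :=
                  (x.mapLE_comp _ _).symm
                rw [h7]
                erw [reassoc_of% hg]
                rw [zero_comp]
              rw [hg', smul_zero]
            · intro T hT hc hkT
              exfalso
              rw [Finset.card_empty, Finset.card_eq_one] at hc
              obtain ⟨a, rfl⟩ := hc
              exact hkT (by
                have := Finset.mem_singleton.1 (hT (Finset.mem_singleton_self a))
                subst this; simp))
          have h8 := hw {k} le_rfl (by simp)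
          rw [hzk] at h8
          have h9 : x.DD {k} w {k} = 0 := by unfold DD; simp
          rw [h9] at h8
          exact zero_of_epi_comp p h8
      rw [Admissible]
      refine ⟨hmono, fun k hk => ?_⟩
      rw [ih _ _ (by rw [Finset.card_erase_of_mem hk, hc]; rfl)]
      refine ⟨fun n => ?_, fun j hj => ?_⟩
      · rw [← x.exactAt_iff_H0 S k hk (fun T hT hkT => hmono T hT k hkT)]
        exact hE n
      · rw [Finset.mem_erase] at hj
        exact ⟨face_H0_adm hk hj.2 hj.1 le_rfl (hF j hj.2).1,
          face_H0_adm hk hj.2 hj.1 (by simp) (hF j hj.2).2⟩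

end Aux

end Cube

/-- Let `S` be a finite set and `x` an `S`-cube in an abelian category.
Then `x` is admissible if and only if the total complex `Tot x` is `0`-spherical (it is a
complex, exact in every positive degree, so that `H_k(Tot x) = 0` for `k ≠ 0`) and all
faces of `x` are admissible. -/
theorem admissible_iff_tot_zero_spherical_and_faces_admissible {𝒜 : Type u}
    [Category.{v} 𝒜] [Abelian 𝒜] {ι : Type w} [LinearOrder ι]
    (x : Cube 𝒜 ι) (S : Finset ι) :
    x.Admissible S ↔
      ((∃ w : ∀ n : ℕ, x.totD S (n+1) ≫ x.totD S n = 0,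
          ∀ n : ℕ, (ShortComplex.mk (x.totD S (n+1)) (x.totD S n) (w n)).Exact) ∧
        ∀ k ∈ S, (x.res (S.erase k) {k}).Admissible (S.erase k) ∧
          (x.res (S.erase k) ∅).Admissible (S.erase k)) := by
  rw [Cube.main S.card x S rfl]
  refine and_congr_left fun _ => ?_
  constructor
  · intro h
    exact ⟨x.totD_totD S, fun n => (x.exact_iff S n).2 (h n)⟩
  · rintro ⟨_, h⟩ n
    exact (x.exact_iff S n).1 (h n)
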